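/- arXiv:1204.5859 — 3 statements merged into one kernel-verified Lean document; each statement's English description precedes it below -/
import Mathlib

section
/- Let P = ⟨H,M,T⟩ be an abduction problem and let r, s, t be three fresh propositional variables not occurring in H, M, or T. Define P' = ⟨H',M',T'⟩ by H' = H ∪ {r,s}, M' = M ∪ {t}, and T' = T ∪ { s → m : m ∈ M ∪ {t} } ∪ { r → t } ∪ { ¬s ∨ ¬h : h ∈ H }. If H₁ ∈ SOL(P) then H₁ ∪ {r} ∈ SOL(P'). -/
/-- Propositional formulas over a set `V` of variables. -/
inductive PropForm (V : Type) : Type where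
  | fls  : PropForm V
  | var  : V → PropForm V
  | neg  : PropForm V → PropForm V
  | conj : PropForm V → PropForm V → PropForm V
  | disj : PropForm V → PropForm V → PropForm V
  | imp  : PropForm V → PropForm V → PropForm V
  deriving DecidableEq

namespace PropForm

/-- Truth of a formula under a valuation. -/
def eval {V : Type} (v : V → Prop) : PropForm V → Prop
  | fls => False
  | var x => v x
  | neg φ => ¬ eval v φ
  | conj φ ψ => eval v φ ∧ eval v ψ
  | disj φ ψ => eval v φ ∨ eval v ψ
  | imp φ ψ => eval v φ → eval v ψ

/-- The set of variables occurring in a formula. -/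
def vars {V : Type} : PropForm V → Set V
  | fls => ∅
  | var x => {x}
  | neg φ => vars φ
  | conj φ ψ => vars φ ∪ vars ψ
  | disj φ ψ => vars φ ∪ vars ψ
  | imp φ ψ => vars φ ∪ vars ψ

end PropForm

/-- An abduction problem `⟨H, M, T⟩`: hypotheses, manifestations, theory. -/
structure AbdProblem (V : Type) [DecidableEq V] : Type where
  H : Finset V
  M : Finset V
  T : Finset (PropForm V)

variable {V : Type} [DecidableEq V]

/-- `v` is a model of the hypotheses `A` together with the theory `T`. -/
def models (v : V → Prop) (A : Finset V) (T : Finset (PropForm V)) : Prop :=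
  (∀ x ∈ A, v x) ∧ (∀ φ ∈ T, φ.eval v)

/-- `A` is a solution of `P`: `A ⊆ H`, `A ∪ T` is satisfiable, `A ∪ T ⊨ m` for `m ∈ M`. -/
def isSol (P : AbdProblem V) (A : Finset V) : Prop :=
  A ⊆ P.H ∧ (∃ v, models v A P.T) ∧ ∀ v, models v A P.T → ∀ m ∈ P.M, v m

/-- The set of solutions of `P`. -/
def SOL (P : AbdProblem V) : Set (Finset V) := {A | isSol P A}

/-- The solutions of `P` minimal under set inclusion. -/
def SOLsub (P : AbdProblem V) : Set (Finset V) :=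
  {A | A ∈ SOL P ∧ ∀ B ∈ SOL P, B ⊆ A → B = A}

/-- The solutions of `P` of minimum cardinality. -/
def SOLcard (P : AbdProblem V) : Set (Finset V) :=
  {A | A ∈ SOL P ∧ ∀ B ∈ SOL P, A.card ≤ B.card}

/-- `x` is fresh for `P`: it occurs neither in `H`, nor in `M`, nor in any formula of `T`. -/
def freshFor (P : AbdProblem V) (x : V) : Prop :=
  x ∉ P.H ∧ x ∉ P.M ∧ ∀ φ ∈ P.T, x ∉ φ.vars

/-- The problem `P' = ⟨H ∪ {r,s}, M ∪ {t},
    T ∪ {s → m : m ∈ M ∪ {t}} ∪ {r → t} ∪ {¬s ∨ ¬h : h ∈ H}⟩`. -/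
def addSol (P : AbdProblem V) (r s t : V) : AbdProblem V where
  H := P.H ∪ {r, s}
  M := P.M ∪ {t}
  T := P.T
    ∪ (P.M ∪ {t}).image (fun m => PropForm.imp (PropForm.var s) (PropForm.var m))
    ∪ {PropForm.imp (PropForm.var r) (PropForm.var t)}
    ∪ P.H.image (fun h => PropForm.disj (PropForm.neg (PropForm.var s)) (PropForm.neg (PropForm.var h)))

/-- The truth of a formula depends only on the values of the variables occurring in it. -/
theorem PropForm.eval_congr {V : Type} {v w : V → Prop} (φ : PropForm V)
    (h : ∀ x ∈ φ.vars, (v x ↔ w x)) : φ.eval v ↔ φ.eval w := by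
  induction φ with
  | fls => rfl
  | var x => exact h x rfl
  | neg φ ih => exact not_congr (ih h)
  | conj φ ψ ihφ ihψ =>
    exact and_congr (ihφ fun x hx => h x (Or.inl hx)) (ihψ fun x hx => h x (Or.inr hx))
  | disj φ ψ ihφ ihψ =>
    exact or_congr (ihφ fun x hx => h x (Or.inl hx)) (ihψ fun x hx => h x (Or.inr hx))
  | imp φ ψ ihφ ihψ =>
    exact imp_congr (ihφ fun x hx => h x (Or.inl hx)) (ihψ fun x hx => h x (Or.inr hx))

/-- A model of `P'` is a model of `P.T` satisfying the added implications and disjunctions. -/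
theorem models_addSol {P : AbdProblem V} {r s t : V} {v : V → Prop} {A : Finset V} :
    models v A (addSol P r s t).T ↔
      models v A P.T ∧ (v s → ∀ m ∈ P.M ∪ {t}, v m) ∧ (v r → v t) ∧
        ∀ h ∈ P.H, ¬ v s ∨ ¬ v h := by
  simp only [models, addSol, Finset.forall_mem_union, Finset.forall_mem_image,
    Finset.mem_singleton, forall_eq, PropForm.eval]
  tauto

theorem solution_plus_r_is_solution (P : AbdProblem V) (r s t : V)
    (hfr : freshFor P r) (hfs : freshFor P s) (hft : freshFor P t)
    (hrs : r ≠ s) (hrt : r ≠ t) (hst : s ≠ t)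
    (H₁ : Finset V) (hH₁ : H₁ ∈ SOL P) :
    H₁ ∪ {r} ∈ SOL (addSol P r s t) := by
  obtain ⟨hsub, ⟨v, hvA, hvT⟩, hent⟩ := hH₁
  refine ⟨Finset.union_subset_union hsub (by simp), ?_, ?_⟩
  · let w : V → Prop := fun x => x ≠ s ∧ (x = r ∨ x = t ∨ v x)
    have hw {x : V} (h₁ : x ≠ r) (h₂ : x ≠ s) (h₃ : x ≠ t) : v x ↔ w x := by
      simp [w, h₁, h₂, h₃]
    have hws : ¬ w s := fun h => h.1 rfl
    refine ⟨w, models_addSol.2 ⟨⟨fun x hx => ?_, fun φ hφ => ?_⟩,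
      fun h => absurd h hws, fun _ => ⟨hst.symm, Or.inr (Or.inl rfl)⟩, fun _ _ => Or.inl hws⟩⟩
    · rcases Finset.mem_union.1 hx with hx | hx
      · exact ⟨fun h => hfs.1 (h ▸ hsub hx), Or.inr (Or.inr (hvA x hx))⟩
      · obtain rfl := Finset.mem_singleton.1 hx
        exact ⟨hrs, Or.inl rfl⟩
    · refine (PropForm.eval_congr φ fun x hx => hw ?_ ?_ ?_).1 (hvT φ hφ)
      · exact fun h => hfr.2.2 φ hφ (h ▸ hx)
      · exact fun h => hfs.2.2 φ hφ (h ▸ hx)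
      · exact fun h => hft.2.2 φ hφ (h ▸ hx)
  · intro u hu m hm
    obtain ⟨⟨huA, huT⟩, -, hrt', -⟩ := models_addSol.1 hu
    rcases Finset.mem_union.1 hm with hm | hm
    · exact hent u ⟨fun x hx => huA x (Finset.mem_union_left _ hx), huT⟩ m hm
    · obtain rfl := Finset.mem_singleton.1 hm
      exact hrt' (huA r (by simp))
end

section
/- Let P = ⟨H,M,T⟩ be an abduction problem whose theory T is a set of clauses over a set V of n propositional variables, let Πₙ denote the set of all clauses over V, and let C = { c_γ : γ ∈ Πₙ } be a set of fresh propositional variables in one-to-one correspondence with Πₙ. For H₁ ⊆ H define H₂ = H₁ ∪ { c_γ : γ ∈ T }, and define P' = ⟨H',M',T'⟩ by H' = H ∪ C, M' = M, and T' = { c_γ → γ : γ ∈ Πₙ }. Then H₁ ∪ T ⊨ m for every m ∈ M if and only if H₂ ∪ T' ⊨ m for every m ∈ M. -/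
variable {V : Type} [DecidableEq V]

/-- A clause, given as a pair (positive variables, negated variables),
    rendered as a disjunction of literals. -/
noncomputable def clauseForm (γ : Finset V × Finset V) : PropForm V :=
  (γ.1.toList.map PropForm.var
    ++ γ.2.toList.map (fun x => PropForm.neg (PropForm.var x))).foldr
    PropForm.disj PropForm.fls

/-- `Πₙ`: the set of all clauses over the variable set `W`. -/
def allClauses (W : Finset V) : Finset (Finset V × Finset V) :=
  W.powerset ×ˢ W.powerset

theorem compile_preserves_entailment (H M W : Finset V) (n : ℕ) (hW : W.card = n)
    (Tc : Finset (Finset V × Finset V)) (hTc : Tc ⊆ allClauses W)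
    (c : Finset V × Finset V → V)
    (hcinj : Set.InjOn c ↑(allClauses W))
    (hcfresh : ∀ γ ∈ allClauses W, freshFor ⟨H, M, Tc.image clauseForm⟩ (c γ))
    (H₁ : Finset V) (hH₁ : H₁ ⊆ H) :
    (∀ v, models v H₁ (Tc.image clauseForm) → ∀ m ∈ M, v m) ↔
    (∀ v, models v (H₁ ∪ Tc.image c)
        ((allClauses W).image (fun γ => PropForm.imp (PropForm.var (c γ)) (clauseForm γ))) →
      ∀ m ∈ M, v m) := by
  constructor
  · intro h v hv
    refine h v ⟨fun x hx => hv.1 x (Finset.mem_union_left _ hx), fun φ hφ => ?_⟩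
    obtain ⟨γ, hγ, rfl⟩ := Finset.mem_image.1 hφ
    exact hv.2 _ (Finset.mem_image_of_mem _ (hTc hγ))
      (hv.1 _ (Finset.mem_union_right _ (Finset.mem_image_of_mem c hγ)))
  · intro h v hv m hm
    -- Make exactly the selectors of the clauses in `Tc` true, and keep `v` elsewhere.
    let w : V → Prop := fun x => x ∈ Tc.image c ∨ (x ∉ (allClauses W).image c ∧ v x)
    have agree : ∀ x, x ∉ (allClauses W).image c → (v x ↔ w x) := fun x hx =>
      ⟨fun hvx => Or.inr ⟨hx, hvx⟩, fun hwx => hwx.elim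
        (fun hxT => absurd (Finset.image_subset_image hTc hxT) hx) And.right⟩
    have fresh : ∀ x, (∀ γ ∈ allClauses W, c γ ≠ x) → (v x ↔ w x) := fun x hx =>
      agree x fun hmem => by
        obtain ⟨γ, hγ, e⟩ := Finset.mem_image.1 hmem
        exact hx γ hγ e
    refine (fresh m fun γ hγ e => (hcfresh γ hγ).2.1 (e ▸ hm)).2 (h w ⟨fun x hx => ?_, ?_⟩ m hm)
    · rcases Finset.mem_union.1 hx with hx | hx
      · exact (fresh x fun γ hγ e => (hcfresh γ hγ).1 (e ▸ hH₁ hx)).1 (hv.1 x hx)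
      · exact Or.inl hx
    · intro φ hφ
      obtain ⟨γ, hγ, rfl⟩ := Finset.mem_image.1 hφ
      intro hwc
      have hγT : γ ∈ Tc := by
        rcases hwc with hwc | hwc
        · obtain ⟨δ, hδ, e⟩ := Finset.mem_image.1 hwc
          exact hcinj (hTc hδ) hγ e ▸ hδ
        · exact absurd (Finset.mem_image_of_mem c hγ) hwc.1
      have hmem := Finset.mem_image_of_mem clauseForm hγT
      exact (PropForm.eval_congr _ fun x hx => fresh x fun δ hδ e =>
        (hcfresh δ hδ).2.2 _ hmem (e ▸ hx)).1 (hv.2 _ hmem)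
end

section
/- Let P = ⟨H,M,T⟩ be an abduction problem whose theory T is a set of clauses over a set V of n propositional variables, let Πₙ denote the set of all clauses over V, and let C = { c_γ : γ ∈ Πₙ } be a set of fresh propositional variables in one-to-one correspondence with Πₙ. For H₁ ⊆ H define H₂ = H₁ ∪ { c_γ : γ ∈ T }, and define P' = ⟨H',M',T'⟩ by H' = H ∪ C, M' = M, and T' = { c_γ → γ : γ ∈ Πₙ }. Then H₁ ∈ SOL(P) if and only if H₂ ∈ SOL(P'). -/
variable {V : Type} [DecidableEq V]

namespace PropForm

theorem eval_congr_s14 {V : Type} {v w : V → Prop} (φ : PropForm V)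
    (h : ∀ x ∈ φ.vars, v x ↔ w x) : φ.eval v ↔ φ.eval w := by
  induction φ with
  | fls => exact Iff.rfl
  | var x => exact h x rfl
  | neg φ ih => exact not_congr (ih h)
  | conj φ ψ ih₁ ih₂ =>
    exact and_congr (ih₁ fun x hx => h x (.inl hx)) (ih₂ fun x hx => h x (.inr hx))
  | disj φ ψ ih₁ ih₂ =>
    exact or_congr (ih₁ fun x hx => h x (.inl hx)) (ih₂ fun x hx => h x (.inr hx))
  | imp φ ψ ih₁ ih₂ =>
    exact imp_congr (ih₁ fun x hx => h x (.inl hx)) (ih₂ fun x hx => h x (.inr hx))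

end PropForm

/-- The valuation that makes `c γ` true exactly for the `γ ∈ Tc`, among the `γ ∈ S`, and agrees
with `v` on all variables that are not of the form `c γ` with `γ ∈ S`. -/
def selectorValuation {ι : Type} (S Tc : Finset ι) (c : ι → V) (v : V → Prop) (x : V) : Prop :=
  x ∈ Tc.image c ∨ (x ∉ S.image c ∧ v x)

theorem selectorValuation_iff {ι : Type} {S Tc : Finset ι} (hTc : Tc ⊆ S) {c : ι → V}
    {v : V → Prop} {x : V} (hx : ∀ γ ∈ S, c γ ≠ x) :
    selectorValuation S Tc c v x ↔ v x := by
  have hS : x ∉ S.image c := by simpa using hx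
  have hT : x ∉ Tc.image c := fun h => hS (Finset.image_subset_image hTc h)
  simp only [selectorValuation, hS, hT, not_false_eq_true, true_and, false_or]

/-- A model of the guarded theory in which the selected guards hold is a model of the selected
formulas. -/
theorem models_of_models_guarded {ι : Type} {S Tc : Finset ι} (hTc : Tc ⊆ S) {c : ι → V}
    {f : ι → PropForm V} {A : Finset V} {v : V → Prop}
    (h : models v (A ∪ Tc.image c) (S.image fun γ => PropForm.imp (PropForm.var (c γ)) (f γ))) :
    models v A (Tc.image f) := by
  refine ⟨fun x hx => h.1 x (Finset.mem_union_left _ hx), fun φ hφ => ?_⟩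
  obtain ⟨γ, hγ, rfl⟩ := Finset.mem_image.1 hφ
  exact h.2 _ (Finset.mem_image_of_mem _ (hTc hγ))
    (h.1 _ (Finset.mem_union_right _ (Finset.mem_image_of_mem c hγ)))

theorem models_guarded_selectorValuation {ι : Type} {S Tc : Finset ι} (hTc : Tc ⊆ S) {c : ι → V}
    (hc : Set.InjOn c ↑S) {f : ι → PropForm V} {A : Finset V} {v : V → Prop}
    (hA : ∀ γ ∈ S, c γ ∉ A) (hf : ∀ γ ∈ S, ∀ φ ∈ Tc.image f, c γ ∉ φ.vars)
    (h : models v A (Tc.image f)) :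
    models (selectorValuation S Tc c v) (A ∪ Tc.image c)
      (S.image fun γ => PropForm.imp (PropForm.var (c γ)) (f γ)) := by
  refine ⟨fun x hx => ?_, fun φ hφ => ?_⟩
  · rcases Finset.mem_union.1 hx with hx | hx
    · exact (selectorValuation_iff hTc fun γ hγ e => hA γ hγ (by rwa [e])).2 (h.1 x hx)
    · exact .inl hx
  · obtain ⟨γ, hγ, rfl⟩ := Finset.mem_image.1 hφ
    rintro (hsel | ⟨hn, -⟩)
    · obtain ⟨δ, hδ, e⟩ := Finset.mem_image.1 hsel
      obtain rfl := hc (hTc hδ) hγ e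
      have hmem := Finset.mem_image_of_mem f hδ
      exact (PropForm.eval_congr_s14 _ fun x hx => selectorValuation_iff hTc
        fun γ' hγ' e' => hf γ' hγ' _ hmem (by rwa [e'])).2 (h.2 _ hmem)
    · exact absurd (Finset.mem_image_of_mem c hγ) hn

theorem compile_preserves_solutions (H M W : Finset V) (n : ℕ) (hW : W.card = n)
    (Tc : Finset (Finset V × Finset V)) (hTc : Tc ⊆ allClauses W)
    (c : Finset V × Finset V → V)
    (hcinj : Set.InjOn c ↑(allClauses W))
    (hcfresh : ∀ γ ∈ allClauses W, freshFor ⟨H, M, Tc.image clauseForm⟩ (c γ))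
    (H₁ : Finset V) (hH₁ : H₁ ⊆ H) :
    H₁ ∈ SOL ⟨H, M, Tc.image clauseForm⟩ ↔
    H₁ ∪ Tc.image c ∈
      SOL ⟨H ∪ (allClauses W).image c, M,
        (allClauses W).image (fun γ => PropForm.imp (PropForm.var (c γ)) (clauseForm γ))⟩ := by
  have hA : ∀ γ ∈ allClauses W, c γ ∉ H₁ := fun γ hγ h => (hcfresh γ hγ).1 (hH₁ h)
  have lift {v : V → Prop} (h : models v H₁ (Tc.image clauseForm)) :=
    models_guarded_selectorValuation hTc hcinj hA (fun γ hγ => (hcfresh γ hγ).2.2) h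
  constructor
  · rintro ⟨-, ⟨v, hv⟩, hM⟩
    exact ⟨Finset.union_subset_union hH₁ (Finset.image_subset_image hTc), ⟨_, lift hv⟩,
      fun w hw => hM w (models_of_models_guarded hTc hw)⟩
  · rintro ⟨-, ⟨v, hv⟩, hM⟩
    exact ⟨hH₁, ⟨v, models_of_models_guarded hTc hv⟩, fun w hw m hm =>
      (selectorValuation_iff hTc fun γ hγ e => (hcfresh γ hγ).2.1 (by rwa [e])).1
        (hM _ (lift hw) m hm)⟩
end
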